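/- Let L be a hermitian O_H-lattice and suppose Λ ∈ Vert(L) satisfies dim_{𝔽_p}((π^{-1}Λ♯ ∩ L♯)/Λ) ≥ 3. Then there exists a lattice Λ' ∈ Vert(L) with Λ ⊊ Λ' and t(Λ') = t(Λ) + 2; in particular t(Λ') > t(Λ). -/

import Mathlib

/- Common setup: ramified quadratic extension H/ℚ_p, ring of integers O_H,
   hermitian forms, lattices, duals, vertex lattices. -/

open scoped Classical

noncomputable section

namespace Ramified

/-- The ring of integers of `H`: the integral closure of `ℤ_p` in `H`. -/
def OH (p : ℕ) [Fact (Nat.Prime p)] (H : Type) [Field H] [Algebra ℚ_[p] H] : Subring H :=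
  letI : Algebra ℤ_[p] H := ((algebraMap ℚ_[p] H).comp PadicInt.Coe.ringHom).toAlgebra
  (integralClosure ℤ_[p] H).toSubring

/-- `H/ℚ_p` is a ramified quadratic extension with nontrivial Galois automorphism `conj`
and uniformizer `ϖ` satisfying `conj ϖ = -ϖ` and `ϖ² = π₀` a uniformizer of `ℤ_p`. -/
structure IsRamifiedQuadratic (p : ℕ) [Fact (Nat.Prime p)] (H : Type) [Field H]
    [Algebra ℚ_[p] H] (conj : H ≃+* H) (ϖ : H) : Prop where
  conj_conj : ∀ x : H, conj (conj x) = x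
  conj_fix : ∀ q : ℚ_[p], conj (algebraMap ℚ_[p] H q) = algebraMap ℚ_[p] H q
  conj_ne : conj ≠ RingEquiv.refl H
  dim_two : Module.finrank ℚ_[p] H = 2
  conj_unif : conj ϖ = -ϖ
  unif_sq : ∃ u : ℤ_[p]ˣ, ϖ * ϖ = algebraMap ℚ_[p] H ((u : ℤ_[p]) : ℚ_[p]) * (p : H)

variable {p : ℕ} [Fact (Nat.Prime p)] {H : Type} [Field H] [Algebra ℚ_[p] H]

/-- Any `H`-module is an `O_H`-module by restriction of scalars. -/
instance moduleOH (C : Type) [AddCommGroup C] [Module H C] : Module (OH p H) C :=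
  Module.compHom C (OH p H).subtype

variable {C : Type} [AddCommGroup C] [Module H C]

theorem oh_smul_def (c : OH p H) (x : C) : c • x = (c : H) • x := rfl

/-- A hermitian form on `C` with respect to the conjugation `conj` of `H`:
linear in the first variable, conjugate-symmetric. -/
structure HermForm (H : Type) [Field H] (C : Type) [AddCommGroup C] [Module H C]
    (conj : H ≃+* H) where
  form : C → C → H
  form_add : ∀ x y z : C, form (x + y) z = form x z + form y z
  form_smul : ∀ (a : H) (x y : C), form (a • x) y = a * form x y
  form_conj : ∀ x y : C, form y x = conj (form x y)

variable {conj : H ≃+* H}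

theorem HermForm.form_zero (φ : HermForm H C conj) (y : C) : φ.form 0 y = 0 := by
  have h := φ.form_smul (0 : H) 0 y
  simpa using h

/-- The dual lattice `Λ♯ = {x : C | φ(x, Λ) ⊆ O_H}`. -/
def HermForm.dual (φ : HermForm H C conj) (Λ : Submodule (OH p H) C) :
    Submodule (OH p H) C where
  carrier := {x : C | ∀ y ∈ Λ, φ.form x y ∈ OH p H}
  add_mem' := by
    intro a b ha hb y hy
    rw [φ.form_add]
    exact add_mem (ha y hy) (hb y hy)
  zero_mem' := by
    intro y hy
    rw [HermForm.form_zero]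
    exact zero_mem _
  smul_mem' := by
    intro c x hx y hy
    show φ.form ((c : H) • x) y ∈ OH p H
    rw [φ.form_smul]
    exact mul_mem c.2 (hx y hy)

/-- The orthogonal complement (in `C = L ⊗ H`) of a sublattice. -/
def HermForm.orthog (φ : HermForm H C conj) (N : Submodule (OH p H) C) :
    Submodule (OH p H) C where
  carrier := {x : C | ∀ y ∈ N, φ.form x y = 0}
  add_mem' := by
    intro a b ha hb y hy
    rw [φ.form_add, ha y hy, hb y hy, add_zero]
  zero_mem' := by
    intro y hy
    rw [HermForm.form_zero]
  smul_mem' := by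
    intro c x hx y hy
    show φ.form ((c : H) • x) y = 0
    rw [φ.form_smul, hx y hy, mul_zero]

/-- Scalar multiplication by `a : H`, as an `O_H`-linear map. -/
def smulMap (a : H) : C →ₗ[OH p H] C where
  toFun x := a • x
  map_add' x y := smul_add a x y
  map_smul' c x := by
    show a • ((c : H) • x) = (c : H) • (a • x)
    rw [smul_comm]

/-- The lattice `a • Λ` for a scalar `a : H`. -/
def scale (a : H) (Λ : Submodule (OH p H) C) : Submodule (OH p H) C :=
  Λ.map (smulMap a)

/-- An `H`-subspace of `C`, viewed as an `O_H`-submodule. -/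
def restrictOH (W : Submodule H C) : Submodule (OH p H) C where
  carrier := (W : Set C)
  add_mem' := fun ha hb => W.add_mem ha hb
  zero_mem' := W.zero_mem
  smul_mem' := fun c x hx => W.smul_mem (c : H) hx

/-- The cardinality of the quotient `Λ/N` (for `N ⊆ Λ` this is the usual quotient). -/
def quotCard (N Λ : Submodule (OH p H) C) : ℕ :=
  Nat.card (Λ ⧸ N.comap Λ.subtype)

/-- A (full) `O_H`-lattice in `C`: finitely generated and spanning `C` over `H`. -/
def IsLattice (Λ : Submodule (OH p H) C) : Prop :=
  Λ.FG ∧ Submodule.span H (Λ : Set C) = ⊤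

/-- A vertex lattice: a full lattice with `ϖΛ ⊆ Λ♯ ⊆ Λ`. -/
def IsVertexLattice (φ : HermForm H C conj) (ϖ : H) (Λ : Submodule (OH p H) C) : Prop :=
  IsLattice Λ ∧ scale ϖ Λ ≤ φ.dual Λ ∧ φ.dual Λ ≤ Λ

/-- `Λ ∈ Vert(L)`: a vertex lattice with `L ⊆ Λ♯`. -/
def InVert (φ : HermForm H C conj) (ϖ : H) (L Λ : Submodule (OH p H) C) : Prop :=
  IsVertexLattice φ ϖ Λ ∧ L ≤ φ.dual Λ

/-- `M` is `a`-modular (e.g. `a = ϖ^i`): `(x, M) = a·O_H` for every maximal `x ∈ M`. -/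
def IsPiModular (φ : HermForm H C conj) (ϖ a : H) (M : Submodule (OH p H) C) : Prop :=
  ∀ x ∈ M, x ∉ scale ϖ M →
    (fun y => φ.form x y) '' (M : Set C) = (fun c => a * c) '' ((OH p H : Set H))

/-- `N` is split: an orthogonal direct sum of hyperbolic planes `H(i)`. -/
def IsSplitLat (φ : HermForm H C conj) (ϖ : H) (N : Submodule (OH p H) C) : Prop :=
  ∃ (s : ℕ) (e f : Fin s → C) (d : Fin s → ℕ),
    N = Submodule.span (OH p H) (Set.range e ∪ Set.range f) ∧
    (∀ j, φ.form (e j) (e j) = 0 ∧ φ.form (f j) (f j) = 0 ∧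
      φ.form (e j) (f j) = ϖ ^ d j) ∧
    ∀ j j', j ≠ j' → φ.form (e j) (e j') = 0 ∧ φ.form (e j) (f j') = 0 ∧
      φ.form (f j) (e j') = 0 ∧ φ.form (f j) (f j') = 0

/-- The `O_H`-rank of a sublattice of `C` (the dimension of the subspace it spans). -/
def rk (N : Submodule (OH p H) C) : ℕ :=
  Module.finrank H (Submodule.span H (N : Set C))

/-- A Jordan splitting `L = ⊕_{0 ≤ λ ≤ k} L_λ` with `L_λ` being `ϖ^λ`-modular (or zero). -/
structure JordanSplitting (φ : HermForm H C conj) (ϖ : H) (L : Submodule (OH p H) C)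
    (k : ℕ) (Lc : ℕ → Submodule (OH p H) C) : Prop where
  sup_eq : L = ⨆ i ∈ Finset.range (k + 1), Lc i
  bot_of_gt : ∀ i, k < i → Lc i = ⊥
  disj : ∀ i ∈ Finset.range (k + 1),
    Disjoint (Lc i) (⨆ j ∈ (Finset.range (k + 1)).erase i, Lc j)
  orthog : ∀ i j, i ≠ j → ∀ x ∈ Lc i, ∀ y ∈ Lc j, φ.form x y = 0
  modular : ∀ i ∈ Finset.range (k + 1), Lc i ≠ ⊥ → IsPiModular φ ϖ (ϖ ^ i) (Lc i)

/-- `L_{≥ t} = ⊕_{λ ≥ t} L_λ`. -/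
def Lge (Lc : ℕ → Submodule (OH p H) C) (k t : ℕ) : Submodule (OH p H) C :=
  ⨆ i ∈ Finset.Icc t k, Lc i

/-- `m(L) = rank_{O_H} L_{≥1}`. -/
def mOf (Lc : ℕ → Submodule (OH p H) C) (k : ℕ) : ℕ :=
  ∑ i ∈ Finset.Icc 1 k, rk (Lc i)

/-- The invariant `t(L)` from Theorem A. -/
def tOf (φ : HermForm H C conj) (ϖ : H) (Lc : ℕ → Submodule (OH p H) C) (k : ℕ) : ℕ :=
  if Odd (mOf Lc k) then mOf Lc k - 1
  else if IsSplitLat φ ϖ (Lge Lc k 1) then mOf Lc k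
  else mOf Lc k - 2

/-- `n_odd = Σ_{λ ≥ 3, λ odd} rank L_λ`. -/
def nOdd (Lc : ℕ → Submodule (OH p H) C) (k : ℕ) : ℕ :=
  ∑ i ∈ (Finset.Icc 3 k).filter (fun i => Odd i), rk (Lc i)

/-- `n_even = Σ_{λ ≥ 2, λ even} rank L_λ`. -/
def nEven (Lc : ℕ → Submodule (OH p H) C) (k : ℕ) : ℕ :=
  ∑ i ∈ (Finset.Icc 2 k).filter (fun i => Even i), rk (Lc i)

end Ramified

namespace Ramified

theorem exists_linear_form_notMem_range (R K : Type*) {V : Type*} [CommRing R] [IsDomain R]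
    [IsPrincipalIdealRing R] [Field K] [Algebra R K] [IsFractionRing R K] [AddCommGroup V]
    [Module K V] [Module R V] [IsScalarTower R K V] {Λ : Submodule R V} (hfg : Λ.FG)
    (hspan : Submodule.span K (Λ : Set V) = ⊤) {x : V} (hx : x ∉ Λ) :
    ∃ g : V →ₗ[K] K, (∀ y ∈ Λ, g y ∈ (algebraMap R K).range) ∧ g x ∉ (algebraMap R K).range := by
  have : Module.Finite R Λ := Module.Finite.iff_fg.2 hfg
  have : Module.IsTorsionFree R V := Module.IsTorsionFree.trans_faithfulSMul R K V
  let b := Module.Free.chooseBasis R Λ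
  have hli : LinearIndependent K (fun i => (b i : V)) :=
    (LinearIndependent.iff_fractionRing R K).1
      (b.linearIndependent.map' Λ.subtype (Submodule.ker_subtype Λ))
  have hsum (y : Λ) : (y : V) = ∑ i, algebraMap R K (b.repr y i) • (b i : V) := by
    simpa only [Submodule.coe_sum, Submodule.coe_smul, algebraMap_smul] using
      congrArg Subtype.val (b.sum_repr y).symm
  let B := Module.Basis.mk hli (by
    rw [← hspan, Submodule.span_le]
    intro y hy
    have h := hsum ⟨y, hy⟩
    dsimp only at h
    rw [h]
    exact Submodule.sum_mem _ fun i _ => Submodule.smul_mem _ _ (Submodule.subset_span ⟨i, rfl⟩))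
  have hB (i) : B i = (b i : V) := by simp [B]
  by_contra! hcon
  have hint (i) : B.coord i x ∈ (algebraMap R K).range := by
    refine hcon (B.coord i) fun y hy => ⟨b.repr ⟨y, hy⟩ i, ?_⟩
    have h := hsum ⟨y, hy⟩
    simp only [← hB] at h
    have h' := congrArg (B.coord i) h
    simpa [Finsupp.single_apply, Algebra.algebraMap_eq_smul_one] using h'.symm
  choose r hr using hint
  apply hx
  rw [← B.sum_repr x]
  refine Submodule.sum_mem _ fun i _ => ?_
  rw [← B.coord_apply, ← hr i, algebraMap_smul, hB]
  exact Λ.smul_mem _ (b i).2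

theorem exists_ne_zero_quadratic_eq_zero {p : ℕ} [Fact (Nat.Prime p)]
    (c : Fin 3 → Fin 3 → ZMod p) :
    ∃ n : Fin 3 → ZMod p, n ≠ 0 ∧ ∑ i, ∑ j, c i j * n i * n j = 0 := by
  let f : MvPolynomial (Fin 3) (ZMod p) :=
    ∑ i, ∑ j, MvPolynomial.C (c i j) * MvPolynomial.X i * MvPolynomial.X j
  have hf (n) : MvPolynomial.eval n f = ∑ i, ∑ j, c i j * n i * n j := by simp [f]
  have hdeg : f.totalDegree < Fintype.card (Fin 3) := by
    refine lt_of_le_of_lt (b := 2) ?_ (by simp)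
    refine MvPolynomial.totalDegree_finsetSum_le fun i _ =>
      MvPolynomial.totalDegree_finsetSum_le fun j _ => ?_
    refine (MvPolynomial.totalDegree_mul _ _).trans ?_
    refine (add_le_add_left (MvPolynomial.totalDegree_mul _ _) _).trans ?_
    simp [MvPolynomial.totalDegree_X]
  have hdvd := char_dvd_card_solutions p hdeg
  let z : { n : Fin 3 → ZMod p // MvPolynomial.eval n f = 0 } := ⟨0, by rw [hf]; simp⟩
  have hcard : 1 < Fintype.card { n : Fin 3 → ZMod p // MvPolynomial.eval n f = 0 } :=
    (Fact.out : p.Prime).one_lt.trans_le (Nat.le_of_dvd (Fintype.card_pos_iff.2 ⟨z⟩) hdvd)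
  obtain ⟨n, hn⟩ := Fintype.exists_ne_of_one_lt_card hcard z
  exact ⟨n, fun h => hn (Subtype.ext h), by rw [← hf]; exact n.2⟩

theorem exists_three_independent {p : ℕ} [Fact (Nat.Prime p)] {V : Type*} [AddCommGroup V]
    (hp : ∀ v : V, p • v = 0) (hcard : p ^ 3 ≤ Nat.card V) :
    ∃ v : Fin 3 → V, ∀ n : Fin 3 → ZMod p, ∑ i, (n i).val • v i = 0 → n = 0 := by
  let : Module (ZMod p) V := AddCommGroup.zmodModule hp
  have hprime : p.Prime := Fact.out
  have : Finite V := Nat.finite_of_card_ne_zero (by have := pow_pos hprime.pos 3; omega)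
  have : Fintype V := Fintype.ofFinite V
  have h3 : 3 ≤ Module.finrank (ZMod p) V := by
    rw [Nat.card_eq_fintype_card, Module.card_eq_pow_finrank (K := ZMod p), ZMod.card] at hcard
    exact (Nat.pow_le_pow_iff_right hprime.one_lt).1 hcard
  obtain ⟨v, hv⟩ := exists_linearIndependent_of_le_finrank h3
  refine ⟨v, fun n hn => funext (Fintype.linearIndependent_iff.1 hv n ?_)⟩
  rw [← hn]
  refine Finset.sum_congr rfl fun i _ => ?_
  rw [← Nat.cast_smul_eq_nsmul (ZMod p), ZMod.natCast_zmod_val]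

theorem card_eq_prime_of_generator {p : ℕ} [Fact (Nat.Prime p)] {V : Type*} [AddCommGroup V]
    {v : V} (hp : p • v = 0) (hv : v ≠ 0) (hgen : ∀ w : V, ∃ n : ℕ, w = n • v) :
    Nat.card V = p := by
  rw [← addOrderOf_eq_prime hp hv, ← Nat.card_zmultiples,
    (AddSubgroup.eq_top_iff' (AddSubgroup.zmultiples v)).2, AddSubgroup.card_top]
  intro w
  obtain ⟨n, rfl⟩ := hgen w
  exact AddSubgroup.nsmul_mem_zmultiples v n
/-- The structure map `ℤ_p → H`. -/
def padicMap (p : ℕ) [Fact (Nat.Prime p)] (H : Type) [Field H] [Algebra ℚ_[p] H] : ℤ_[p] →+* H :=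
  (algebraMap ℚ_[p] H).comp PadicInt.Coe.ringHom

section RingOfIntegers

variable {p : ℕ} [Fact (Nat.Prime p)] {H : Type} [Field H] [Algebra ℚ_[p] H]
  {conj : H ≃+* H} {ϖ : H}

theorem padicMap_apply (u : ℤ_[p]) : padicMap p H u = algebraMap ℚ_[p] H u := rfl

theorem mem_OH_iff_isIntegralElem {a : H} : a ∈ OH p H ↔ (padicMap p H).IsIntegralElem a := Iff.rfl

theorem padicMap_mem_OH (u : ℤ_[p]) : padicMap p H u ∈ OH p H :=
  mem_OH_iff_isIntegralElem.2 (RingHom.isIntegralElem_map _)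

theorem algebraMap_mem_OH_iff {q : ℚ_[p]} : algebraMap ℚ_[p] H q ∈ OH p H ↔ ‖q‖ ≤ 1 := by
  refine ⟨fun ⟨f, hf, h0⟩ => ?_, fun h => padicMap_mem_OH (⟨q, h⟩ : ℤ_[p])⟩
  have h1 : algebraMap ℚ_[p] H (f.eval₂ (algebraMap ℤ_[p] ℚ_[p]) q) = 0 := by
    rw [Polynomial.hom_eval₂]
    exact h0
  have h2 : IsIntegral ℤ_[p] q := ⟨f, hf, (map_eq_zero _).1 h1⟩
  obtain ⟨y, rfl⟩ := IsIntegrallyClosed.isIntegral_iff.1 h2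
  exact y.2

namespace IsRamifiedQuadratic

theorem conj_mem (hram : IsRamifiedQuadratic p H conj ϖ) {a : H} (ha : a ∈ OH p H) :
    conj a ∈ OH p H := by
  obtain ⟨f, hf, h0⟩ := ha
  refine mem_OH_iff_isIntegralElem.2 ⟨f, hf, ?_⟩
  have hc : (conj : H →+* H).comp (padicMap p H) = padicMap p H :=
    RingHom.ext fun u => hram.conj_fix u
  have h1 : (conj : H →+* H) (f.eval₂ (padicMap p H) a) = 0 := (map_eq_zero _).2 h0
  rw [Polynomial.hom_eval₂, hc] at h1
  exact h1

theorem conj_mem_iff (hram : IsRamifiedQuadratic p H conj ϖ) {a : H} :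
    conj a ∈ OH p H ↔ a ∈ OH p H :=
  ⟨fun h => hram.conj_conj a ▸ hram.conj_mem h, hram.conj_mem⟩

theorem exists_unif_sq (hram : IsRamifiedQuadratic p H conj ϖ) :
    ∃ u : ℤ_[p]ˣ, ϖ * ϖ = padicMap p H (u * p) := by
  obtain ⟨u, hu⟩ := hram.unif_sq
  exact ⟨u, by rw [hu, map_mul, map_natCast]; rfl⟩

theorem charZero (_ : IsRamifiedQuadratic p H conj ϖ) : CharZero H :=
  charZero_of_injective_algebraMap (algebraMap ℚ_[p] H).injective

theorem unif_ne_zero (hram : IsRamifiedQuadratic p H conj ϖ) : ϖ ≠ 0 := by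
  rintro rfl
  obtain ⟨u, hu⟩ := hram.exists_unif_sq
  have hinj : Function.Injective (padicMap p H) :=
    (algebraMap ℚ_[p] H).injective.comp Subtype.val_injective
  rw [mul_zero, eq_comm, map_eq_zero_iff _ hinj] at hu
  exact mul_ne_zero u.ne_zero (Nat.cast_ne_zero.2 (Fact.out : p.Prime).ne_zero) hu

theorem unif_mem (hram : IsRamifiedQuadratic p H conj ϖ) : ϖ ∈ OH p H := by
  obtain ⟨u, hu⟩ := hram.exists_unif_sq
  refine mem_OH_iff_isIntegralElem.2
    ⟨Polynomial.X ^ 2 - Polynomial.C ((u : ℤ_[p]) * p), Polynomial.monic_X_pow_sub_C _ two_ne_zero,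
      ?_⟩
  simp [hu, sq]

/-- `p` is a multiple of `ϖ ^ 2` in the ring of integers. -/
theorem exists_natCast_eq (hram : IsRamifiedQuadratic p H conj ϖ) :
    ∃ c ∈ OH p H, (p : H) = ϖ * (ϖ * c) := by
  obtain ⟨u, hu⟩ := hram.exists_unif_sq
  refine ⟨padicMap p H (u⁻¹ : ℤ_[p]ˣ), padicMap_mem_OH _, ?_⟩
  rw [← mul_assoc, hu, ← map_mul, mul_right_comm, Units.mul_inv, one_mul, map_natCast]

theorem exists_eq_add_mul_unif (hram : IsRamifiedQuadratic p H conj ϖ) (a : H) :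
    ∃ u v : ℚ_[p], a = algebraMap ℚ_[p] H u + algebraMap ℚ_[p] H v * ϖ := by
  have := hram.charZero
  have hli : LinearIndependent ℚ_[p] ![(1 : H), ϖ] := by
    rw [LinearIndependent.pair_iff' one_ne_zero]
    intro q hq
    have h1 := hram.conj_fix q
    rw [Algebra.algebraMap_eq_smul_one, hq, hram.conj_unif, neg_eq_self] at h1
    exact hram.unif_ne_zero h1
  have hspan := hli.span_eq_top_of_card_eq_finrank (by simp [hram.dim_two])
  have ha : a ∈ Submodule.span ℚ_[p] (Set.range ![(1 : H), ϖ]) := hspan ▸ Submodule.mem_top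
  rw [Matrix.range_cons_cons_empty, Submodule.mem_span_pair] at ha
  obtain ⟨u, v, rfl⟩ := ha
  exact ⟨u, v, by simp [Algebra.smul_def]⟩

theorem algebraMap_add_mul_unif_mem (hp : p ≠ 2) (hram : IsRamifiedQuadratic p H conj ϖ)
    {u v : ℚ_[p]} (h : algebraMap ℚ_[p] H u + algebraMap ℚ_[p] H v * ϖ ∈ OH p H) :
    ‖u‖ ≤ 1 ∧ ‖v‖ ≤ 1 := by
  have hprime : p.Prime := Fact.out
  have hu : ‖u‖ ≤ 1 := by
    have h1 := add_mem h (hram.conj_mem h)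
    rw [map_add, map_mul, hram.conj_fix, hram.conj_fix, hram.conj_unif, mul_neg,
      add_add_add_comm, add_neg_cancel, add_zero, ← map_add, algebraMap_mem_OH_iff, ← two_mul,
      norm_mul] at h1
    have h2 : ‖((2 : ℕ) : ℚ_[p])‖ = 1 := by
      rw [Padic.norm_natCast_eq_one_iff]
      exact (Nat.coprime_primes hprime Nat.prime_two).2 hp
    rw [Nat.cast_ofNat] at h2
    rwa [h2, one_mul] at h1
  refine ⟨hu, ?_⟩
  obtain ⟨w, hw⟩ := hram.exists_unif_sq
  have h1 := sub_mem h (algebraMap_mem_OH_iff.2 hu)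
  rw [add_sub_cancel_left] at h1
  have h2 := mul_mem h1 h1
  rw [mul_mul_mul_comm, hw, padicMap_apply, ← map_mul, ← map_mul, algebraMap_mem_OH_iff] at h2
  push_cast at h2
  rw [norm_mul, norm_mul, norm_mul, PadicInt.padic_norm_e_of_padicInt, PadicInt.norm_units, one_mul,
    Padic.norm_p] at h2
  by_contra! hv
  have hp0 : (0 : ℝ) < p := Nat.cast_pos.2 hprime.pos
  have hpv : (p : ℝ) ≤ ‖v‖ := by
    have h3 : ¬ ‖v‖ < (p : ℝ) ^ ((0 : ℤ) + 1) := by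
      rw [← Padic.norm_le_pow_iff_norm_lt_pow_add_one, zpow_zero]
      exact hv.not_ge
    simpa using h3
  rw [← div_eq_mul_inv, div_le_one hp0] at h2
  have hp1 : (1 : ℝ) < p := Nat.one_lt_cast.2 hprime.one_lt
  nlinarith

theorem mem_OH_iff (hp : p ≠ 2) (hram : IsRamifiedQuadratic p H conj ϖ) {a : H} :
    a ∈ OH p H ↔ ∃ u v : ℤ_[p], a = padicMap p H u + padicMap p H v * ϖ := by
  constructor
  · intro ha
    obtain ⟨u, v, rfl⟩ := hram.exists_eq_add_mul_unif a
    obtain ⟨hu, hv⟩ := hram.algebraMap_add_mul_unif_mem hp ha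
    exact ⟨⟨u, hu⟩, ⟨v, hv⟩, rfl⟩
  · rintro ⟨u, v, rfl⟩
    exact add_mem (padicMap_mem_OH _) (mul_mem (padicMap_mem_OH _) hram.unif_mem)

/-- The residue field of `O_H` is `𝔽_p`. -/
theorem exists_natCast_sub (hp : p ≠ 2) (hram : IsRamifiedQuadratic p H conj ϖ) {a : H}
    (ha : a ∈ OH p H) : ∃ n : ℕ, ∃ c ∈ OH p H, a = n + ϖ * c := by
  obtain ⟨u, v, rfl⟩ := (hram.mem_OH_iff hp).1 ha
  obtain ⟨d, hd, hpd⟩ := hram.exists_natCast_eq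
  have h1 := PadicInt.appr_spec 1 u
  rw [pow_one, Ideal.mem_span_singleton] at h1
  obtain ⟨w, hw⟩ := h1
  refine ⟨u.appr 1, padicMap p H v + ϖ * d * padicMap p H w,
    add_mem (padicMap_mem_OH _) (mul_mem (mul_mem hram.unif_mem hd) (padicMap_mem_OH _)), ?_⟩
  have h2 := congrArg (padicMap p H) (sub_eq_iff_eq_add.1 hw)
  rw [map_add, map_mul, map_natCast, map_natCast, hpd] at h2
  rw [h2]
  ring

/-- Elements of `O_H` outside `ϖ O_H` are invertible modulo `ϖ`. -/
theorem exists_mul_eq_one_add (hp : p ≠ 2) (hram : IsRamifiedQuadratic p H conj ϖ) {a : H}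
    (ha : a ∈ OH p H) (hna : ∀ c ∈ OH p H, a ≠ ϖ * c) :
    ∃ m : ℕ, ∃ c ∈ OH p H, m * a = 1 + ϖ * c := by
  obtain ⟨n, c, hc, rfl⟩ := hram.exists_natCast_sub hp ha
  obtain ⟨d, hd, hpd⟩ := hram.exists_natCast_eq
  have hprime : p.Prime := Fact.out
  have hn : ¬ p ∣ n := by
    rintro ⟨k, rfl⟩
    refine hna (ϖ * d * k + c)
      (add_mem (mul_mem (mul_mem hram.unif_mem hd) (natCast_mem _ k)) hc) ?_
    push_cast
    rw [hpd]
    ring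
  obtain ⟨m, -, hm⟩ := Nat.exists_mul_mod_eq_one_of_coprime
    ((Nat.Prime.coprime_iff_not_dvd hprime).2 hn).symm hprime.one_lt
  refine ⟨m, ϖ * d * ((n * m / p : ℕ) : H) + m * c, add_mem (mul_mem (mul_mem hram.unif_mem hd)
    (natCast_mem _ _)) (mul_mem (natCast_mem _ m) hc), ?_⟩
  have h1 := congrArg (Nat.cast : ℕ → H) (Nat.mod_add_div (n * m) p)
  rw [hm] at h1
  push_cast at h1
  rw [hpd] at h1
  linear_combination -h1

end IsRamifiedQuadratic

end RingOfIntegers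

section Lattices

variable {p : ℕ} [Fact (Nat.Prime p)] {H : Type} [Field H] [Algebra ℚ_[p] H]
  {conj : H ≃+* H} {ϖ : H} {C : Type} [AddCommGroup C] [Module H C]

namespace HermForm

/-- The hermitian form as a linear form in its first variable. -/
def linearLeft (φ : HermForm H C conj) (y : C) : C →ₗ[H] H where
  toFun x := φ.form x y
  map_add' x z := φ.form_add x z y
  map_smul' a x := φ.form_smul a x y

theorem form_add_right (φ : HermForm H C conj) (x y z : C) :
    φ.form x (y + z) = φ.form x y + φ.form x z := by
  rw [φ.form_conj (y + z), φ.form_add, map_add, ← φ.form_conj, ← φ.form_conj]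

theorem form_smul_right (φ : HermForm H C conj) (a : H) (x y : C) :
    φ.form x (a • y) = conj a * φ.form x y := by
  rw [φ.form_conj (a • y), φ.form_smul, map_mul, ← φ.form_conj]

/-- The hermitian form as an additive map in its second variable. -/
def addRight (φ : HermForm H C conj) (x : C) : C →+ H :=
  AddMonoidHom.mk' (φ.form x) (φ.form_add_right x)

theorem form_sum_natCast_smul (φ : HermForm H C conj) {ι : Type} [Fintype ι] (k : ι → ℕ)
    (x : ι → C) :
    φ.form (∑ i, k i • x i) (∑ i, k i • x i) = ∑ i, ∑ j, (k i : H) * k j * φ.form (x i) (x j) := by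
  have h1 (z : C) : φ.form (∑ i, k i • x i) z = ∑ i, (k i : H) * φ.form (x i) z := by
    refine (map_sum (φ.linearLeft z) (fun i => k i • x i) Finset.univ).trans ?_
    simp only [map_nsmul, nsmul_eq_mul]
    rfl
  have h2 (z : C) : φ.form z (∑ i, k i • x i) = ∑ i, (k i : H) * φ.form z (x i) := by
    refine (map_sum (φ.addRight z) (fun i => k i • x i) Finset.univ).trans ?_
    simp only [map_nsmul, nsmul_eq_mul]
    rfl
  rw [h1]
  simp only [h2, Finset.mul_sum, mul_assoc]

/-- Every linear form is represented by a nondegenerate hermitian form. -/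
theorem exists_form_eq [FiniteDimensional H C] (φ : HermForm H C conj)
    (hconj : ∀ a, conj (conj a) = a) (hnd : ∀ x : C, (∀ y : C, φ.form x y = 0) → x = 0)
    (f : C →ₗ[H] H) : ∃ y : C, ∀ x, f x = φ.form x y := by
  let W : Submodule H (Module.Dual H C) :=
    { carrier := Set.range φ.linearLeft
      add_mem' := by
        rintro _ _ ⟨y, rfl⟩ ⟨z, rfl⟩
        exact ⟨y + z, LinearMap.ext fun x => φ.form_add_right x y z⟩
      zero_mem' := ⟨0, LinearMap.ext fun x => (φ.addRight x).map_zero⟩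
      smul_mem' := by
        rintro a _ ⟨y, rfl⟩
        refine ⟨conj a • y, LinearMap.ext fun x => ?_⟩
        exact (φ.form_smul_right _ x y).trans (by rw [hconj]; rfl) }
  have hbot : W.dualCoannihilator = ⊥ := by
    rw [eq_bot_iff]
    intro x hx
    rw [Submodule.mem_dualCoannihilator] at hx
    exact hnd x fun y => hx _ ⟨y, rfl⟩
  have htop : W = ⊤ := by
    rw [← Subspace.dualCoannihilator_dualAnnihilator_eq (W := W), hbot,
      Submodule.dualAnnihilator_bot]
  obtain ⟨y, hy⟩ : f ∈ W := htop ▸ Submodule.mem_top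
  exact ⟨y, fun x => (LinearMap.congr_fun hy x).symm⟩

theorem mem_dual {φ : HermForm H C conj} {Λ : Submodule (OH p H) C} {x : C} :
    x ∈ φ.dual Λ ↔ ∀ y ∈ Λ, φ.form x y ∈ OH p H := Iff.rfl

theorem dual_anti (φ : HermForm H C conj) {Λ Λ' : Submodule (OH p H) C} (h : Λ ≤ Λ') :
    φ.dual Λ' ≤ φ.dual Λ := fun _ hx y hy => hx y (h hy)

end HermForm

theorem smul_mem_of_mem_OH (N : Submodule (OH p H) C) {a : H} (ha : a ∈ OH p H) {x : C}
    (hx : x ∈ N) : a • x ∈ N := N.smul_mem (⟨a, ha⟩ : OH p H) hx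

theorem scale_le_iff {a : H} {N M : Submodule (OH p H) C} :
    scale a N ≤ M ↔ ∀ x ∈ N, a • x ∈ M := Submodule.map_le_iff_le_comap

theorem mem_scale_inv_iff {a : H} (ha : a ≠ 0) {N : Submodule (OH p H) C} {x : C} :
    x ∈ scale a⁻¹ N ↔ a • x ∈ N := by
  constructor
  · rintro ⟨y, hy, rfl⟩
    simpa [smulMap, ha] using hy
  · intro h
    exact ⟨a • x, h, inv_smul_smul₀ ha x⟩

theorem quotCard_eq_relIndex (N M : Submodule (OH p H) C) :
    quotCard N M = N.toAddSubgroup.relIndex M.toAddSubgroup := rfl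

theorem quotCard_mul_quotCard {N M P : Submodule (OH p H) C} (hNM : N ≤ M) (hMP : M ≤ P) :
    quotCard N M * quotCard M P = quotCard N P := by
  simp only [quotCard_eq_relIndex]
  exact AddSubgroup.relIndex_mul_relIndex _ _ _ hNM hMP

theorem IsLattice.finiteDimensional {Λ : Submodule (OH p H) C} (hΛ : IsLattice Λ) :
    FiniteDimensional H C := by
  obtain ⟨S, rfl⟩ := hΛ.1
  refine ⟨⟨S, eq_top_iff.2 ?_⟩⟩
  rw [← hΛ.2, Submodule.span_le]
  intro x hx
  induction hx using Submodule.span_induction with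
  | mem x hx => exact Submodule.subset_span hx
  | zero => exact zero_mem _
  | add x y _ _ hx hy => exact add_mem hx hy
  | smul a x _ hx => exact Submodule.smul_mem _ (a : H) hx

namespace IsRamifiedQuadratic

/-- A lattice is separated from points outside it by linear forms. -/
theorem exists_linear_form_notMem (hp : p ≠ 2) (hram : IsRamifiedQuadratic p H conj ϖ)
    {Λ : Submodule (OH p H) C} (hΛ : IsLattice Λ) {x : C} (hx : x ∉ Λ) :
    ∃ f : C →ₗ[H] H, (∀ y ∈ Λ, f y ∈ OH p H) ∧ f x ∉ OH p H := by
  let : Module ℚ_[p] C := Module.compHom C (algebraMap ℚ_[p] H)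
  have hQ (q : ℚ_[p]) (y : C) : q • y = algebraMap ℚ_[p] H q • y := rfl
  let : Module ℤ_[p] C := Module.compHom C (padicMap p H)
  have hZ (u : ℤ_[p]) (y : C) : u • y = padicMap p H u • y := rfl
  have : IsScalarTower ℤ_[p] ℚ_[p] C := ⟨fun u q y => by
    rw [hQ, hZ, hQ, smul_smul, Algebra.smul_def, map_mul]; rfl⟩
  let Λ₀ : Submodule ℤ_[p] C :=
    { Λ.toAddSubgroup with
      smul_mem' := fun u y hy => smul_mem_of_mem_OH Λ (padicMap_mem_OH u) hy }
  have hmem {y : C} : y ∈ Λ₀ ↔ y ∈ Λ := Iff.rfl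
  have hfg : Λ₀.FG := by
    obtain ⟨S, hS⟩ := hΛ.1
    refine ⟨S ∪ S.image (ϖ • ·), ?_⟩
    rw [Finset.coe_union, Finset.coe_image]
    set T := Submodule.span ℤ_[p] ((S : Set C) ∪ (ϖ • ·) '' (S : Set C)) with hT
    have hϖT : ∀ y ∈ T, ϖ • y ∈ T := by
      intro y hy
      obtain ⟨w, hw⟩ := hram.exists_unif_sq
      induction hy using Submodule.span_induction with
      | mem y hy =>
        rcases hy with hy | ⟨y, hy, rfl⟩
        · exact Submodule.subset_span (Or.inr ⟨y, hy, rfl⟩)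
        · dsimp only
          rw [smul_smul, hw]
          exact Submodule.smul_mem T _ (Submodule.subset_span (Or.inl hy))
      | zero => rw [smul_zero]; exact zero_mem T
      | add y z _ _ hy hz => rw [smul_add]; exact add_mem hy hz
      | smul r y _ hy =>
        rw [hZ, smul_comm]
        exact Submodule.smul_mem T r hy
    refine le_antisymm (Submodule.span_le.2 ?_) fun y hy => ?_
    · have hSΛ : ∀ y ∈ S, y ∈ Λ := fun y hy => hS.le (Submodule.subset_span hy)
      rintro y (hy | ⟨y, hy, rfl⟩)
      · exact hSΛ y hy
      · exact smul_mem_of_mem_OH Λ hram.unif_mem (hSΛ y hy)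
    · rw [hmem, ← hS] at hy
      induction hy using Submodule.span_induction with
      | mem y hy => exact Submodule.subset_span (Or.inl hy)
      | zero => exact zero_mem T
      | add y z _ _ hy hz => exact add_mem hy hz
      | smul a y _ hy =>
        obtain ⟨u, v, huv⟩ := (hram.mem_OH_iff hp).1 a.2
        rw [oh_smul_def, huv, add_smul, mul_smul]
        exact add_mem (Submodule.smul_mem T u hy) (Submodule.smul_mem T v (hϖT y hy))
  have hspan : Submodule.span ℚ_[p] (Λ₀ : Set C) = ⊤ := by
    rw [eq_top_iff]
    intro y _
    have hy : y ∈ Submodule.span H (Λ : Set C) := hΛ.2 ▸ Submodule.mem_top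
    induction hy using Submodule.closure_induction with
    | zero => exact zero_mem _
    | add y z _ _ hy hz => exact add_mem (hy trivial) (hz trivial)
    | smul_mem a y hy =>
      obtain ⟨u, v, rfl⟩ := hram.exists_eq_add_mul_unif a
      rw [add_smul, mul_smul]
      exact add_mem (Submodule.smul_mem _ u (Submodule.subset_span hy)) (Submodule.smul_mem _ v
        (Submodule.subset_span (smul_mem_of_mem_OH Λ hram.unif_mem hy)))
  have hrange {q : ℚ_[p]} : q ∈ (algebraMap ℤ_[p] ℚ_[p]).range ↔ ‖q‖ ≤ 1 :=
    ⟨fun ⟨u, hu⟩ => hu ▸ u.2, fun h => ⟨⟨q, h⟩, rfl⟩⟩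
  obtain ⟨g, hg, hgx⟩ := exists_linear_form_notMem_range ℤ_[p] ℚ_[p] hfg hspan (mt hmem.1 hx)
  rw [hrange] at hgx
  have hgs (q : ℚ_[p]) (y : C) : g (algebraMap ℚ_[p] H q • y) = q * g y := g.map_smul q y
  obtain ⟨w, hw⟩ := hram.exists_unif_sq
  let f : C →ₗ[H] H :=
    { toFun := fun y => algebraMap ℚ_[p] H (g (ϖ • y)) + algebraMap ℚ_[p] H (g y) * ϖ
      map_add' := fun y z => by simp only [smul_add, map_add]; ring
      map_smul' := fun a y => by
        obtain ⟨u, v, rfl⟩ := hram.exists_eq_add_mul_unif a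
        have h1 : g ((algebraMap ℚ_[p] H u + algebraMap ℚ_[p] H v * ϖ) • y) =
            u * g y + v * g (ϖ • y) := by
          rw [add_smul, mul_smul, map_add, hgs, hgs]
        have h2 : g (ϖ • (algebraMap ℚ_[p] H u + algebraMap ℚ_[p] H v * ϖ) • y) =
            u * g (ϖ • y) + v * (((w * p : ℤ_[p]) : ℚ_[p]) * g y) := by
          rw [add_smul, mul_smul, smul_add, smul_comm ϖ (algebraMap ℚ_[p] H u) y,
            smul_comm ϖ (algebraMap ℚ_[p] H v) (ϖ • y), smul_smul ϖ ϖ, hw,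
            padicMap_apply, map_add, hgs, hgs, hgs]
        rw [h1, h2]
        simp only [map_add, map_mul, ← padicMap_apply, RingHom.id_apply, smul_eq_mul] at hw ⊢
        linear_combination (-algebraMap ℚ_[p] H v * algebraMap ℚ_[p] H (g y)) * hw }
  refine ⟨f, fun y hy => ?_, fun h => hgx (hram.algebraMap_add_mul_unif_mem hp h).2⟩
  have hy' : ϖ • y ∈ Λ := smul_mem_of_mem_OH Λ hram.unif_mem hy
  exact add_mem (algebraMap_mem_OH_iff.2 (hrange.1 (hg _ hy')))
    (mul_mem (algebraMap_mem_OH_iff.2 (hrange.1 (hg _ hy))) hram.unif_mem)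

/-- Reflexivity of lattices: points outside `Λ` pair non-integrally with some vector of `Λ♯`. -/
theorem exists_mem_dual_form_notMem (hp : p ≠ 2) (hram : IsRamifiedQuadratic p H conj ϖ)
    {φ : HermForm H C conj} (hnd : ∀ x : C, (∀ y : C, φ.form x y = 0) → x = 0)
    {Λ : Submodule (OH p H) C} (hΛ : IsLattice Λ) {x : C} (hx : x ∉ Λ) :
    ∃ y ∈ φ.dual Λ, φ.form y x ∉ OH p H := by
  have := hΛ.finiteDimensional
  obtain ⟨f, hf, hfx⟩ := hram.exists_linear_form_notMem hp hΛ hx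
  obtain ⟨y, hy⟩ := φ.exists_form_eq hram.conj_conj hnd f
  refine ⟨y, fun z hz => ?_, ?_⟩
  · rw [φ.form_conj, ← hy]
    exact hram.conj_mem (hf z hz)
  · rwa [φ.form_conj, hram.conj_mem_iff, ← hy]

theorem natCast_smul_mem (hram : IsRamifiedQuadratic p H conj ϖ) {N : Submodule (OH p H) C}
    {x : C} (hx : ϖ • x ∈ N) : p • x ∈ N := by
  obtain ⟨d, hd, hpd⟩ := hram.exists_natCast_eq
  rw [← Nat.cast_smul_eq_nsmul H, hpd, mul_comm, mul_smul]
  exact smul_mem_of_mem_OH N (mul_mem hram.unif_mem hd) hx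

theorem quotCard_eq_prime (hp : p ≠ 2) (hram : IsRamifiedQuadratic p H conj ϖ)
    {N M : Submodule (OH p H) C} {x : C} (hxM : x ∈ M) (hxN : x ∉ N) (hϖ : ϖ • x ∈ N)
    (hgen : ∀ y ∈ M, ∃ c ∈ OH p H, y - c • x ∈ N) : quotCard N M = p := by
  refine card_eq_prime_of_generator
    (v := (Submodule.Quotient.mk ⟨x, hxM⟩ : M ⧸ N.comap M.subtype)) ?_ ?_ fun w => ?_
  · rw [← Submodule.Quotient.mk_smul, Submodule.Quotient.mk_eq_zero]
    exact hram.natCast_smul_mem hϖ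
  · rw [Ne, Submodule.Quotient.mk_eq_zero]
    exact hxN
  · obtain ⟨⟨y, hy⟩, rfl⟩ := Submodule.Quotient.mk_surjective _ w
    obtain ⟨c, hc, hyc⟩ := hgen y hy
    obtain ⟨n, d, hd, rfl⟩ := hram.exists_natCast_sub hp hc
    refine ⟨n, ?_⟩
    rw [← Submodule.Quotient.mk_smul, Submodule.Quotient.eq]
    change y - n • x ∈ N
    have h1 := add_mem hyc (smul_mem_of_mem_OH N hd hϖ)
    rw [add_smul, Nat.cast_smul_eq_nsmul, mul_comm, mul_smul] at h1
    convert h1 using 1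
    abel

/-- An isotropic line in `(ϖ⁻¹Λ♯ ∩ L♯)/Λ`. -/
theorem exists_isotropic (hp : p ≠ 2) (hram : IsRamifiedQuadratic p H conj ϖ)
    {φ : HermForm H C conj} {U Λ : Submodule (OH p H) C} (hΛ : φ.dual Λ ≤ Λ)
    (hU : ∀ x ∈ U, ϖ • x ∈ φ.dual Λ) (hcard : p ^ 3 ≤ quotCard Λ U) :
    ∃ x ∈ U, x ∉ Λ ∧ ϖ * φ.form x x ∈ OH p H := by
  obtain ⟨v, hv⟩ := exists_three_independent (p := p) (V := U ⧸ Λ.comap U.subtype) (by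
    intro w
    obtain ⟨⟨y, hy⟩, rfl⟩ := Submodule.Quotient.mk_surjective _ w
    rw [← Submodule.Quotient.mk_smul, Submodule.Quotient.mk_eq_zero]
    exact hram.natCast_smul_mem (hΛ (hU y hy))) hcard
  choose x hx using fun i => Submodule.Quotient.mk_surjective _ (v i)
  have hint (i j) : ϖ * ϖ * φ.form (x i) (x j) ∈ OH p H := by
    have h1 := neg_mem (hU _ (x i).2 _ (hΛ (hU _ (x j).2)))
    rw [φ.form_smul, φ.form_smul_right, hram.conj_unif] at h1
    convert h1 using 1
    ring
  choose c d hd hcd using fun i j => hram.exists_natCast_sub hp (hint i j)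
  obtain ⟨n, hn0, hn⟩ := exists_ne_zero_quadratic_eq_zero (fun i j => (c i j : ZMod p))
  refine ⟨∑ i, (n i).val • (x i : C), U.sum_mem fun i _ => U.nsmul_mem (x i).2 _,
    fun hmem => hn0 (hv n ?_), ?_⟩
  · simp only [← hx, ← Submodule.Quotient.mk_smul]
    have h1 := (Submodule.Quotient.mk_eq_zero (Λ.comap U.subtype)
      (x := ∑ i, (n i).val • x i)).2 (by simpa using hmem)
    rwa [← Submodule.mkQ_apply, map_sum] at h1
  · have hdvd : p ∣ ∑ i, ∑ j, c i j * (n i).val * (n j).val := by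
      rw [← ZMod.natCast_eq_zero_iff]
      push_cast
      simpa using hn
    obtain ⟨m, hm⟩ := hdvd
    obtain ⟨e, he, hpe⟩ := hram.exists_natCast_eq
    have hm' := congrArg (Nat.cast : ℕ → H) hm
    push_cast at hm'
    rw [hpe] at hm'
    have key : ϖ * (ϖ * φ.form (∑ i, (n i).val • (x i : C)) (∑ i, (n i).val • (x i : C))) =
        ϖ * (ϖ * e * m + ∑ i, ∑ j, ((n i).val : H) * (n j).val * d i j) := by
      rw [φ.form_sum_natCast_smul, ← mul_assoc, mul_add,
        show ϖ * (ϖ * e * m) = ϖ * (ϖ * e) * m by ring, ← hm', Finset.mul_sum,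
        Finset.mul_sum, ← Finset.sum_add_distrib]
      refine Finset.sum_congr rfl fun i _ => ?_
      rw [Finset.mul_sum, Finset.mul_sum, ← Finset.sum_add_distrib]
      refine Finset.sum_congr rfl fun j _ => ?_
      linear_combination ((n i).val : H) * (n j).val * hcd i j
    rw [mul_left_cancel₀ hram.unif_ne_zero key]
    exact add_mem (mul_mem (mul_mem hram.unif_mem he) (natCast_mem _ m)) (sum_mem fun i _ =>
      sum_mem fun j _ => mul_mem (mul_mem (natCast_mem _ _) (natCast_mem _ _)) (hd i j))

end IsRamifiedQuadratic

end Lattices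

/-- If `Λ ∈ Vert(L)` and `dim_{𝔽_p}((ϖ⁻¹Λ♯ ∩ L♯)/Λ) ≥ 3`, then there is
`Λ' ∈ Vert(L)` with `Λ ⊊ Λ'` and `t(Λ') = t(Λ) + 2` (in particular `t(Λ') > t(Λ)`). -/
theorem statement_4 (p : ℕ) [Fact (Nat.Prime p)] (hp : p ≠ 2)
    (H : Type) [Field H] [Algebra ℚ_[p] H] (conj : H ≃+* H) (ϖ : H)
    (hram : IsRamifiedQuadratic p H conj ϖ)
    (C : Type) [AddCommGroup C] [Module H C]
    (φ : HermForm H C conj)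
    (hnd : ∀ x : C, (∀ y : C, φ.form x y = 0) → x = 0)
    (L Λ : Submodule (OH p H) C) (t : ℕ)
    (hL : IsLattice L)
    (hΛ : InVert φ ϖ L Λ)
    (ht : quotCard (φ.dual Λ) Λ = p ^ t)
    (hdim3 : p ^ 3 ≤ quotCard Λ (scale ϖ⁻¹ (φ.dual Λ) ⊓ φ.dual L)) :
    ∃ Λ' : Submodule (OH p H) C, InVert φ ϖ L Λ' ∧ Λ < Λ' ∧
      quotCard (φ.dual Λ') Λ' = p ^ (t + 2) := by
  have hprime : p.Prime := Fact.out
  obtain ⟨⟨hlat, hϖΛ, hdualΛ⟩, hLΛ⟩ := hΛ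
  rw [scale_le_iff] at hϖΛ
  obtain ⟨x, hxU, hxΛ, hxx⟩ := hram.exists_isotropic hp hdualΛ
    (fun y hy => (mem_scale_inv_iff hram.unif_ne_zero).1 (Submodule.mem_inf.1 hy).1) hdim3
  have hϖx : ϖ • x ∈ φ.dual Λ := (mem_scale_inv_iff hram.unif_ne_zero).1 hxU.1
  let Λ' : Submodule (OH p H) C := Λ ⊔ Submodule.span (OH p H) {x}
  have hmem {y : C} : y ∈ Λ' ↔ ∃ l ∈ Λ, ∃ c ∈ OH p H, l + c • x = y := by
    simp only [Λ', Submodule.mem_sup, Submodule.mem_span_singleton]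
    constructor
    · rintro ⟨l, hl, _, ⟨c, rfl⟩, rfl⟩
      exact ⟨l, hl, c, c.2, rfl⟩
    · rintro ⟨l, hl, c, hc, rfl⟩
      exact ⟨l, hl, _, ⟨⟨c, hc⟩, rfl⟩, rfl⟩
  have hle : Λ ≤ Λ' := le_sup_left
  have hxΛ' : x ∈ Λ' := Submodule.mem_sup_right (Submodule.mem_span_singleton_self x)
  have hdual {y : C} : y ∈ φ.dual Λ' ↔ y ∈ φ.dual Λ ∧ φ.form y x ∈ OH p H := by
    refine ⟨fun h => ⟨φ.dual_anti hle h, h x hxΛ'⟩, fun ⟨h1, h2⟩ z hz => ?_⟩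
    obtain ⟨l, hl, c, hc, rfl⟩ := hmem.1 hz
    rw [φ.form_add_right, φ.form_smul_right]
    exact add_mem (h1 l hl) (mul_mem (hram.conj_mem hc) h2)
  have hϖdual {y : C} (hy : y ∈ φ.dual Λ) : ϖ * φ.form y x ∈ OH p H := by
    have h1 := neg_mem (hy _ (hdualΛ hϖx))
    rwa [φ.form_smul_right, hram.conj_unif, neg_mul, neg_neg] at h1
  have hϖxΛ' : ϖ • x ∈ φ.dual Λ' := hdual.2 ⟨hϖx, by rwa [φ.form_smul]⟩
  have hϖΛ' : ∀ y ∈ Λ', ϖ • y ∈ φ.dual Λ' := by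
    intro y hy
    obtain ⟨l, hl, c, hc, rfl⟩ := hmem.1 hy
    rw [smul_add, smul_comm]
    refine add_mem (hdual.2 ⟨hϖΛ l hl, ?_⟩) (smul_mem_of_mem_OH _ hc hϖxΛ')
    have h1 := neg_mem (hram.conj_mem (hϖx l hl))
    rwa [← φ.form_conj, φ.form_smul_right, hram.conj_unif, neg_mul, neg_neg, ← φ.form_smul] at h1
  have hxL : ∀ y ∈ L, φ.form y x ∈ OH p H := by
    intro y hy
    rw [φ.form_conj x y]
    exact hram.conj_mem (hxU.2 y hy)
  refine ⟨Λ', ⟨⟨⟨?_, ?_⟩, scale_le_iff.2 hϖΛ', fun y hy => hle (hdualΛ (hdual.1 hy).1)⟩,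
    fun y hy => hdual.2 ⟨hLΛ hy, hxL y hy⟩⟩, ?_, ?_⟩
  · exact hlat.1.sup (Submodule.fg_span_singleton x)
  · exact top_le_iff.1 (hlat.2 ▸ Submodule.span_mono hle)
  · exact lt_of_le_of_ne hle fun h => hxΛ (h ▸ hxΛ')
  · have hupper : quotCard Λ Λ' = p := by
      refine hram.quotCard_eq_prime hp hxΛ' hxΛ (hdualΛ hϖx) fun y hy => ?_
      obtain ⟨l, hl, c, hc, rfl⟩ := hmem.1 hy
      exact ⟨c, hc, by rwa [add_sub_cancel_right]⟩
    have hlower : quotCard (φ.dual Λ') (φ.dual Λ) = p := by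
      obtain ⟨z, hz, hzx⟩ := hram.exists_mem_dual_form_notMem hp hnd hlat hxΛ
      refine hram.quotCard_eq_prime hp hz (fun h => hzx (hdual.1 h).2)
        (hϖΛ' z (hle (hdualΛ hz))) fun y hy => ?_
      obtain ⟨m, c, hc, hmc⟩ := hram.exists_mul_eq_one_add hp (hϖdual hz)
        fun c hc h => hzx (mul_left_cancel₀ hram.unif_ne_zero h ▸ hc)
      have ha : m * (ϖ * φ.form y x) ∈ OH p H := mul_mem (natCast_mem _ m) (hϖdual hy)
      refine ⟨_, ha, hdual.2 ⟨sub_mem hy (smul_mem_of_mem_OH _ ha hz), ?_⟩⟩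
      have h1 : φ.form (y - (m * (ϖ * φ.form y x)) • z) x = -((ϖ * φ.form y x) * c) := by
        rw [sub_eq_add_neg, ← neg_smul, φ.form_add, φ.form_smul]
        linear_combination -φ.form y x * hmc
      rw [h1]
      exact neg_mem (mul_mem (hϖdual hy) hc)
    have hdual_le : φ.dual Λ' ≤ φ.dual Λ := φ.dual_anti hle
    rw [← quotCard_mul_quotCard (hdual_le.trans hdualΛ) hle, ← quotCard_mul_quotCard hdual_le hdualΛ,
      hlower, ht, hupper]
    ring

end Ramified
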